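/- Let B ⊆ A be linear subspaces of ℝ^d with dim B = b ≥ 1 and dim A = a, b ≤ a ≤ d, and let ψ, φ : [1,∞) → (0,∞) be decreasing functions with ψ(T) ≤ 1 for all T. Then there is a constant κ > 0 depending only on d such that for every T ≥ 1: (i) for every v ∈ ℝ^d, the shifted set Π_T + v can be covered by at most κ·μ_T translates of Ω_T, and (ii) the set Π_{2T} can be covered by at most κ·μ_T translates of Ω_T, where μ_T = (T/ψ(T))^{a−b} · max{1, (φ(T)/ψ(T))^{d−a}}. -/

import Mathlib

open MeasureTheory Filter

noncomputable section

/-- The sup-norm of a vector in Euclidean space. -/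
def supNorm {d : ℕ} (w : EuclideanSpace ℝ (Fin d)) : ℝ := ⨆ i, |w i|

/-- The point of `ℝ^d` (with Euclidean metric) corresponding to an integer vector. -/
def intVec {d : ℕ} (z : Fin d → ℤ) : EuclideanSpace ℝ (Fin d) :=
  (WithLp.equiv 2 (Fin d → ℝ)).symm (fun i => (z i : ℝ))

/-- The irrationality measure function `ψ_B` of a linear subspace of `ℝ^d`:
`ψ_B(t) = inf { dist(z, B) : z ∈ ℤ^d, 1 ≤ |z| < t }`. -/
def psiSub {d : ℕ} (B : Submodule ℝ (EuclideanSpace ℝ (Fin d))) (t : ℝ) : ℝ :=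
  sInf ((fun z : Fin d → ℤ =>
      Metric.infDist (intVec z) (B : Set (EuclideanSpace ℝ (Fin d)))) ''
    {z | 1 ≤ supNorm (intVec z) ∧ supNorm (intVec z) < t})

/-- The Diophantine exponent of a linear subspace of `ℝ^d`:
`ω(B) = sup { γ : liminf_{t→∞} t^γ ψ_B(t) < ∞ }`, as an extended real number. -/
def diophExp {d : ℕ} (B : Submodule ℝ (EuclideanSpace ℝ (Fin d))) : EReal :=
  sSup {x : EReal | ∃ γ : ℝ, x = (γ : EReal) ∧
    Filter.liminf (fun t : ℝ => ENNReal.ofReal (t ^ γ * psiSub B t)) Filter.atTop < ⊤}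

/-- The graph subspace `C(Θ)` of an `(a-c)×c` matrix `Θ`, relative to an orthonormal
basis `e` of an `a`-dimensional subspace of `ℝ^d`:
`C(Θ) = { ∑ x_j e_j + ∑_i (∑_j θ_{ij} x_j) e_{c+i} : x ∈ ℝ^c }`. -/
def graphSub (d a c : ℕ) (hca : c ≤ a) (e : Fin a → EuclideanSpace ℝ (Fin d))
    (Θ : Fin (a - c) → Fin c → ℝ) : Submodule ℝ (EuclideanSpace ℝ (Fin d)) :=
  Submodule.span ℝ {v | ∃ x : Fin c → ℝ,
    v = (∑ j : Fin c, x j • e (Fin.castLE hca j)) +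
        ∑ i : Fin (a - c), (∑ j : Fin c, Θ i j * x j) • e ⟨c + i.1, by have := i.2; omega⟩}

/-- `μ_T = (T/ψ(T))^{a−b} · max{1, (φ(T)/ψ(T))^{d−a}}` for `T ≥ 1`, and `μ_T = 0` for `T < 1`. -/
def muF (a b d : ℕ) (ψ φ : ℝ → ℝ) (T : ℝ) : ℝ :=
  if T < 1 then 0 else (T / ψ T) ^ (a - b) * max 1 ((φ T / ψ T) ^ (d - a))

/-- `M_T = Σ_{j=0}^{⌊log₂ T⌋} μ_{T/2^j}` for integers `T ≥ 1` (and `M_0 = 0`). -/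
def MF (a b d : ℕ) (ψ φ : ℝ → ℝ) (T : ℕ) : ℝ :=
  ∑ j ∈ Finset.range (Nat.log 2 T + 1), muF a b d ψ φ ((T : ℝ) / 2 ^ j)

/-- `λ_T = M_T − M_{T−1}` for integers `T ≥ 1`. -/
def lamF (a b d : ℕ) (ψ φ : ℝ → ℝ) (T : ℕ) : ℝ :=
  MF a b d ψ φ T - MF a b d ψ φ (T - 1)

theorem OrthonormalBasis.norm_le_sum_abs_repr {ι E : Type*} [Fintype ι] [NormedAddCommGroup E]
    [InnerProductSpace ℝ E] (e : OrthonormalBasis ι ℝ E) (x : E) :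
    ‖x‖ ≤ ∑ i, |e.repr x i| := by
  calc ‖x‖ = ‖∑ i, e.repr x i • e i‖ := by rw [e.sum_repr]
    _ ≤ ∑ i, ‖e.repr x i • e i‖ := norm_sum_le _ _
    _ = ∑ i, |e.repr x i| := by simp [norm_smul]

theorem OrthonormalBasis.abs_repr_le_norm {ι E : Type*} [Fintype ι] [NormedAddCommGroup E]
    [InnerProductSpace ℝ E] (e : OrthonormalBasis ι ℝ E) (x : E) (i : ι) :
    |e.repr x i| ≤ ‖x‖ := by
  simpa using PiLp.norm_apply_le (e.repr x) i

theorem supNorm_le_norm {d : ℕ} (w : EuclideanSpace ℝ (Fin d)) : supNorm w ≤ ‖w‖ :=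
  Real.iSup_le (fun i => PiLp.norm_apply_le w i) (norm_nonneg w)

theorem norm_le_card_mul_supNorm {d : ℕ} (w : EuclideanSpace ℝ (Fin d)) :
    ‖w‖ ≤ d * supNorm w := by
  calc ‖w‖ ≤ ∑ i, |w i| := by
        simpa using (EuclideanSpace.basisFun (Fin d) ℝ).norm_le_sum_abs_repr w
    _ ≤ ∑ _i : Fin d, supNorm w :=
        Finset.sum_le_sum fun i _ => le_ciSup (f := fun i => |w i|) (Set.finite_range _).bddAbove i
    _ = d * supNorm w := by simp

/-- A ball of radius `R` in an `n`-dimensional Euclidean space is covered by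
`O_n(max(1, R/r)^n)` balls of radius `r`. -/
theorem exists_finset_closedBall_cover (E : Type*) [NormedAddCommGroup E]
    [InnerProductSpace ℝ E] [FiniteDimensional ℝ E] {R r : ℝ} (hR : 0 ≤ R) (hr : 0 < r) :
    ∃ F : Finset E,
      (F.card : ℝ) ≤ ((2 * Module.finrank ℝ E + 5) * max 1 (R / r)) ^ Module.finrank ℝ E ∧
      ∀ x : E, ‖x‖ ≤ R → ∃ u ∈ F, ‖x - u‖ ≤ r := by
  classical
  set n := Module.finrank ℝ E with hn
  let e := stdOrthonormalBasis ℝ E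
  set s : ℝ := r / (n + 1) with hs
  have hs0 : 0 < s := by positivity
  set N : ℕ := ⌊R / s⌋₊ + 1 with hN
  refine ⟨(Fintype.piFinset fun _ : Fin n => Finset.Icc (-(N : ℤ)) N).image
    fun k => ∑ i, (s * k i) • e i, ?_, fun x hx => ?_⟩
  · have hcard : (Finset.Icc (-(N : ℤ)) N).card = 2 * N + 1 := by
      rw [Int.card_Icc]; omega
    refine (Nat.cast_le.2 Finset.card_image_le).trans ?_
    rw [Fintype.card_piFinset]
    simp only [hcard, Finset.prod_const, Finset.card_univ, Fintype.card_fin]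
    push_cast
    refine pow_le_pow_left₀ (by positivity) ?_ _
    have h1 : (⌊R / s⌋₊ : ℝ) ≤ R / s := Nat.floor_le (by positivity)
    have h2 : R / s = (n + 1) * (R / r) := by rw [hs]; field_simp
    have h3 := le_max_left 1 (R / r)
    have h4 : (n + 1 : ℝ) * (R / r) ≤ (n + 1) * max 1 (R / r) := by gcongr; exact le_max_right _ _
    rw [hN]; push_cast
    nlinarith
  · set k : Fin n → ℤ := fun i => round (e.repr x i / s) with hk
    refine ⟨∑ i, (s * k i) • e i, Finset.mem_image_of_mem _ ?_, ?_⟩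
    · rw [Fintype.mem_piFinset]
      intro i
      have h1 : |e.repr x i / s| ≤ R / s := by
        rw [abs_div, abs_of_pos hs0]
        gcongr
        exact (e.abs_repr_le_norm x i).trans hx
      have h2 := abs_sub_round (e.repr x i / s)
      have h3 := Nat.lt_floor_add_one (R / s)
      rw [abs_le] at h1 h2
      have hN' : (N : ℝ) = ⌊R / s⌋₊ + 1 := by rw [hN]; push_cast; ring
      have h4 : (k i : ℝ) < N + 1 := by simp only [hk]; linarith
      have h5 : -(N + 1 : ℝ) < k i := by simp only [hk]; linarith
      have h6 : k i < N + 1 := by exact_mod_cast h4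
      have h7 : -(N + 1 : ℤ) < k i := by exact_mod_cast h5
      rw [Finset.mem_Icc]
      omega
    · refine (e.norm_le_sum_abs_repr _).trans ?_
      have hcoord : ∀ j, |e.repr (x - ∑ i, (s * k i) • e i) j| ≤ s := by
        intro j
        have h1 : e.repr (x - ∑ i, (s * k i) • e i) j = s * (e.repr x j / s - k j) := by
          have : e.repr (∑ i, (s * k i) • e i) j = s * k j := by
            rw [e.repr_apply_apply, e.orthonormal.inner_right_fintype]
          rw [map_sub, PiLp.sub_apply, this]
          field_simp
        rw [h1, abs_mul, abs_of_pos hs0]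
        have h2 := abs_sub_round (e.repr x j / s)
        calc s * |e.repr x j / s - k j| ≤ s * 1 := by gcongr; simp only [hk]; linarith
          _ = s := mul_one s
      refine (Finset.sum_le_sum fun j _ => hcoord j).trans ?_
      simp only [Finset.sum_const, Finset.card_univ, Fintype.card_fin, nsmul_eq_mul]
      rw [← hn, hs, ← mul_div_assoc, div_le_iff₀ (by positivity)]
      nlinarith

theorem Submodule.infDist_eq_norm_sub_starProjection {E : Type*} [NormedAddCommGroup E]
    [InnerProductSpace ℝ E] (K : Submodule ℝ E) [K.HasOrthogonalProjection] (x : E) :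
    Metric.infDist x (K : Set E) = ‖x - K.starProjection x‖ := by
  rw [K.starProjection_minimal, Metric.infDist_eq_iInf]
  simp only [dist_eq_norm]
  rfl

/-- The parallelepiped of size `2T` along `A` and `f` across `A` is covered by translates of the
one of size `T` along `B` and `p` across `B`. -/
theorem exists_finset_translate_cover {d : ℕ} {B A : Submodule ℝ (EuclideanSpace ℝ (Fin d))}
    (hBA : B ≤ A) {T p f : ℝ} (hT : 1 ≤ T) (hp : 0 < p) (hp1 : p ≤ 1) (hf : 0 < f) :
    ∃ F : Finset (EuclideanSpace ℝ (Fin d)),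
      (F.card : ℝ) ≤ ((2 * d + 5) * (6 * d + 3)) ^ d *
        ((T / p) ^ (Module.finrank ℝ A - Module.finrank ℝ B) *
          max 1 ((f / p) ^ (d - Module.finrank ℝ A))) ∧
      ∀ w : EuclideanSpace ℝ (Fin d), supNorm w ≤ 2 * T →
        Metric.infDist w (A : Set (EuclideanSpace ℝ (Fin d))) ≤ f →
        ∃ u ∈ F, supNorm (w - u) ≤ T ∧
          Metric.infDist (w - u) (B : Set (EuclideanSpace ℝ (Fin d))) ≤ p := by
  classical
  have hT0 : 0 < T := by linarith
  set a := Module.finrank ℝ A with ha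
  set b := Module.finrank ℝ B with hb
  have hba : b ≤ a := Submodule.finrank_mono hBA
  have had : a ≤ d := by simpa using Submodule.finrank_le A
  have hC : Module.finrank ℝ (Bᗮ ⊓ A : Submodule ℝ (EuclideanSpace ℝ (Fin d))) = a - b := by
    have := Submodule.finrank_add_inf_finrank_orthogonal hBA
    omega
  have hD : Module.finrank ℝ Aᗮ = d - a := by
    have := A.finrank_add_finrank_orthogonal
    rw [finrank_euclideanSpace_fin] at this
    omega
  set C := Bᗮ ⊓ A
  have hR : 0 ≤ d * (2 * T) := by positivity
  obtain ⟨F₁, hF₁, hc₁⟩ := exists_finset_closedBall_cover B hR (show 0 < T / 3 by positivity)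
  obtain ⟨F₂, hF₂, hc₂⟩ := exists_finset_closedBall_cover C hR (show 0 < p / 3 by positivity)
  obtain ⟨F₃, hF₃, hc₃⟩ := exists_finset_closedBall_cover Aᗮ hf.le (show 0 < p / 3 by positivity)
  rw [← hb] at hF₁
  rw [hC] at hF₂
  rw [hD] at hF₃
  refine ⟨(F₁ ×ˢ F₂ ×ˢ F₃).image fun q => (q.1 : EuclideanSpace ℝ (Fin d)) + q.2.1 + q.2.2,
    ?_, fun w hw hwA => ?_⟩
  · set M : ℝ := (2 * d + 5) * (6 * d + 3) with hM
    have hTp : 1 ≤ T / p := by rw [le_div_iff₀ hp]; linarith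
    have hd : (0 : ℝ) ≤ d := Nat.cast_nonneg d
    have bound : ∀ {n : ℕ} {x y : ℝ}, n ≤ d → max 1 x ≤ (6 * d + 3) * y →
        ((2 * (n : ℝ) + 5) * max 1 x) ^ n ≤ M ^ n * y ^ n := by
      intro n x y hnd hxy
      rw [← mul_pow, hM, mul_assoc]
      have : (n : ℝ) ≤ d := by exact_mod_cast hnd
      gcongr
    have h₁ := hF₁.trans (bound (y := 1) (hba.trans had) (by
      have : (d * (2 * T) / (T / 3) : ℝ) = 6 * d := by field_simp; ring
      rw [this]
      exact max_le (by linarith) (by linarith)))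
    have h₂ := hF₂.trans (bound (y := T / p) (by omega) (by
      have : (d * (2 * T) / (p / 3) : ℝ) = 6 * d * (T / p) := by field_simp; ring
      rw [this]
      exact max_le (by nlinarith) (by nlinarith)))
    have h₃ := hF₃.trans (bound (y := max 1 (f / p)) (by omega) (by
      have : f / (p / 3) = 3 * (f / p) := by field_simp
      rw [this]
      have h1 := le_max_left 1 (f / p)
      have h2 := le_max_right 1 (f / p)
      exact max_le (by nlinarith) (by nlinarith)))
    have hmax : max 1 (f / p) ^ (d - a) = max 1 ((f / p) ^ (d - a)) := by
      rcases le_total 1 (f / p) with h | h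
      · rw [max_eq_right h, max_eq_right (one_le_pow₀ h)]
      · rw [max_eq_left h, max_eq_left (pow_le_one₀ (by positivity) h), one_pow]
    refine (Nat.cast_le.2 Finset.card_image_le).trans ?_
    rw [Finset.card_product, Finset.card_product]
    push_cast
    calc (F₁.card : ℝ) * (F₂.card * F₃.card)
        ≤ (M ^ b * 1 ^ b) * ((M ^ (a - b) * (T / p) ^ (a - b)) *
            (M ^ (d - a) * max 1 (f / p) ^ (d - a))) := by gcongr
      _ = M ^ (b + (a - b) + (d - a)) * ((T / p) ^ (a - b) * max 1 (f / p) ^ (d - a)) := by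
          rw [one_pow, pow_add, pow_add]; ring
      _ = _ := by rw [hmax, show b + (a - b) + (d - a) = d by omega]
  · have hwn : ‖w‖ ≤ d * (2 * T) := (norm_le_card_mul_supNorm w).trans (by gcongr)
    have hxC : A.starProjection w - B.starProjection w ∈ C := by
      refine Submodule.mem_inf.2 ⟨?_, A.sub_mem (A.starProjection_apply_mem w)
        (hBA (B.starProjection_apply_mem w))⟩
      have h1 : w - B.starProjection w ∈ Bᗮ := B.sub_starProjection_mem_orthogonal w
      have h2 : w - A.starProjection w ∈ Bᗮ :=
        Submodule.orthogonal_le hBA (A.sub_starProjection_mem_orthogonal w)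
      simpa using Bᗮ.sub_mem h1 h2
    have hx₂ : ‖A.starProjection w - B.starProjection w‖ ≤ ‖w‖ := by
      have h : B.starProjection (A.starProjection w) = B.starProjection w := by
        have h2 : w - A.starProjection w ∈ Bᗮ :=
          Submodule.orthogonal_le hBA (A.sub_starProjection_mem_orthogonal w)
        have h3 := (B.starProjection_apply_eq_zero_iff).2 h2
        rw [map_sub, sub_eq_zero] at h3
        exact h3.symm
      rw [← h, ← Submodule.starProjection_orthogonal_val]
      exact (Submodule.norm_starProjection_apply_le _ _).trans
        (Submodule.norm_starProjection_apply_le _ _)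
    obtain ⟨u₁, hu₁, h₁⟩ := hc₁ ⟨B.starProjection w, B.starProjection_apply_mem w⟩
      ((B.norm_starProjection_apply_le w).trans hwn)
    obtain ⟨u₂, hu₂, h₂⟩ := hc₂ ⟨_, hxC⟩ (hx₂.trans hwn)
    obtain ⟨u₃, hu₃, h₃⟩ := hc₃ ⟨_, A.sub_starProjection_mem_orthogonal w⟩
      (by rwa [A.infDist_eq_norm_sub_starProjection] at hwA)
    replace h₁ : ‖B.starProjection w - u₁‖ ≤ T / 3 := h₁
    replace h₂ : ‖A.starProjection w - B.starProjection w - u₂‖ ≤ p / 3 := h₂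
    replace h₃ : ‖w - A.starProjection w - u₃‖ ≤ p / 3 := h₃
    refine ⟨_, Finset.mem_image_of_mem _ (Finset.mk_mem_product hu₁
      (Finset.mk_mem_product hu₂ hu₃)), ?_, ?_⟩
    · refine (supNorm_le_norm _).trans ?_
      have h : w - ((u₁ : EuclideanSpace ℝ (Fin d)) + u₂ + u₃) = (B.starProjection w - u₁) +
          (A.starProjection w - B.starProjection w - u₂) + (w - A.starProjection w - u₃) := by
        abel
      rw [h]
      refine norm_add₃_le.trans ?_
      linarith
    · refine (Metric.infDist_le_dist_of_mem
        (B.sub_mem (B.starProjection_apply_mem w) u₁.2)).trans ?_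
      rw [dist_eq_norm]
      have h : w - ((u₁ : EuclideanSpace ℝ (Fin d)) + u₂ + u₃) - (B.starProjection w - u₁) =
          (A.starProjection w - B.starProjection w - u₂) + (w - A.starProjection w - u₃) := by
        abel
      rw [h]
      refine (norm_add_le _ _).trans ?_
      linarith

/-- Remark to Lemma 1: there is a constant `κ > 0` depending only on `d` such
that for all subspaces `B ⊆ A` of `ℝ^d` and functions `ψ, φ` as in Lemma 1 and every `T ≥ 1`:
(i) every shifted set `Π_T + v` can be covered by at most `κ·μ_T` translates of `Ω_T`, and
(ii) `Π_{2T}` can be covered by at most `κ·μ_T` translates of `Ω_T`. -/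
theorem stmt_4 (d : ℕ) :
    ∃ κ : ℝ, 0 < κ ∧
      ∀ (a b : ℕ) (B A : Submodule ℝ (EuclideanSpace ℝ (Fin d))) (ψ φ : ℝ → ℝ),
        1 ≤ b → b ≤ a → a ≤ d → B ≤ A →
        Module.finrank ℝ B = b → Module.finrank ℝ A = a →
        (∀ T : ℝ, 1 ≤ T → 0 < ψ T) → (∀ T : ℝ, 1 ≤ T → 0 < φ T) →
        AntitoneOn ψ (Set.Ici 1) → AntitoneOn φ (Set.Ici 1) →
        (∀ T : ℝ, 1 ≤ T → ψ T ≤ 1) →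
        ∀ T : ℝ, 1 ≤ T →
          (∀ v : EuclideanSpace ℝ (Fin d),
            ∃ F : Finset (EuclideanSpace ℝ (Fin d)),
              (F.card : ℝ) ≤ κ * muF a b d ψ φ T ∧
              (fun w => w + v) ''
                  {w : EuclideanSpace ℝ (Fin d) | supNorm w ≤ T ∧
    Metric.infDist w (A : Set (EuclideanSpace ℝ (Fin d))) ≤ φ T} ⊆
                ⋃ u ∈ F, (fun w => w + u) ''
                  {w : EuclideanSpace ℝ (Fin d) | supNorm w ≤ T ∧
                    Metric.infDist w (B : Set (EuclideanSpace ℝ (Fin d))) ≤ ψ T}) ∧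
          ∃ F : Finset (EuclideanSpace ℝ (Fin d)),
            (F.card : ℝ) ≤ κ * muF a b d ψ φ T ∧
            {w : EuclideanSpace ℝ (Fin d) | supNorm w ≤ 2 * T ∧
                Metric.infDist w (A : Set (EuclideanSpace ℝ (Fin d))) ≤ φ (2 * T)} ⊆
              ⋃ u ∈ F, (fun w => w + u) ''
                {w : EuclideanSpace ℝ (Fin d) | supNorm w ≤ T ∧
                  Metric.infDist w (B : Set (EuclideanSpace ℝ (Fin d))) ≤ ψ T} := by
  classical
  refine ⟨((2 * d + 5) * (6 * d + 3)) ^ d, by positivity, ?_⟩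
  intro a b B A ψ φ _ _ _ hBA hb ha hψ hφ _ hφa hψ1 T hT
  obtain ⟨F, hF, hcov⟩ := exists_finset_translate_cover hBA hT (hψ T hT) (hψ1 T hT) (hφ T hT)
  rw [ha, hb] at hF
  have hmu : muF a b d ψ φ T =
      (T / ψ T) ^ (a - b) * max 1 ((φ T / ψ T) ^ (d - a)) := if_neg hT.not_gt
  rw [hmu]
  refine ⟨fun v => ⟨F.image (· + v), (Nat.cast_le.2 Finset.card_image_le).trans hF, ?_⟩,
    F, hF, ?_⟩
  · rintro _ ⟨w, ⟨hw, hwA⟩, rfl⟩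
    obtain ⟨u, hu, h⟩ := hcov w (by linarith) hwA
    exact Set.mem_biUnion (Finset.mem_coe.2 (Finset.mem_image_of_mem _ hu))
      ⟨w - u, h, by simp only []; abel⟩
  · rintro w ⟨hw, hwA⟩
    have hφ2 : φ (2 * T) ≤ φ T :=
      hφa (Set.mem_Ici.2 hT) (Set.mem_Ici.2 (by linarith)) (by linarith)
    obtain ⟨u, hu, h⟩ := hcov w hw (hwA.trans hφ2)
    exact Set.mem_biUnion (Finset.mem_coe.2 hu) ⟨w - u, h, sub_add_cancel w u⟩

end
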